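/- Let b ∈ ℝ³ with ‖b‖ = 1, let β > 0, and let k ≥ 2 be an integer. Define the linear map L : ℝ³ × ℝ³ → ℝ³ × ℝ³ by L(V⁺, V⁻) = ( β·(V⁺ × b) − k·β·V⁻ , β·(V⁻ × b) + k·β·V⁺ ). Then L is a linear bijection, and its inverse is given explicitly by: L⁻¹(s⁺, s⁻) = (V⁺, V⁻) with V⁺ = (1/(k·β))·( (b·s⁻)·b + (k²/(k²−1))·((b × s⁻) × b) + (k/(k²−1))·(s⁺ × b) ) and V⁻ = −(1/(k·β))·( (b·s⁺)·b + (k²/(k²−1))·((b × s⁺) × b) − (k/(k²−1))·(s⁻ × b) ). -/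

import Mathlib

open Real

noncomputable section

abbrev E3 : Type := EuclideanSpace ℝ (Fin 3)

/-- The cross product on `ℝ³`. -/
def cross (u v : E3) : E3 :=
  (WithLp.equiv 2 (Fin 3 → ℝ)).symm
    ![u 1 * v 2 - u 2 * v 1, u 2 * v 0 - u 0 * v 2, u 0 * v 1 - u 1 * v 0]

/-- The dot product on `ℝ³`. -/
def dot (u v : E3) : ℝ := u 0 * v 0 + u 1 * v 1 + u 2 * v 2

/-- The curl of a vector field on `ℝ³`, defined componentwise from the Fréchet derivative. -/
def curl (A : E3 → E3) (x : E3) : E3 :=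
  (WithLp.equiv 2 (Fin 3 → ℝ)).symm
    ![fderiv ℝ A x (EuclideanSpace.single 1 1) 2 - fderiv ℝ A x (EuclideanSpace.single 2 1) 1,
      fderiv ℝ A x (EuclideanSpace.single 2 1) 0 - fderiv ℝ A x (EuclideanSpace.single 0 1) 2,
      fderiv ℝ A x (EuclideanSpace.single 0 1) 1 - fderiv ℝ A x (EuclideanSpace.single 1 1) 0]

lemma cross_add_left (u v w : E3) : cross (u + v) w = cross u w + cross v w := by
  ext i; fin_cases i <;> simp [cross] <;> ring

lemma cross_smul_left (c : ℝ) (u w : E3) : cross (c • u) w = c • cross u w := by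
  ext i; fin_cases i <;> simp [cross] <;> ring

lemma cross_self_eq_zero (u : E3) : cross u u = 0 := by
  ext i; fin_cases i <;> simp [cross] <;> ring

lemma dot_self_eq_norm_sq (b : E3) : dot b b = ‖b‖ ^ 2 := by
  rw [EuclideanSpace.real_norm_sq_eq, Fin.sum_univ_three, dot]
  ring

lemma cross_cross_left_right (b v : E3) :
    cross (cross b v) b = dot b b • v - dot b v • b := by
  ext i; fin_cases i <;> simp [cross, dot] <;> ring

lemma cross_cross_right_right (b v : E3) :
    cross (cross v b) b = dot b v • b - dot b b • v := by
  ext i; fin_cases i <;> simp [cross, dot] <;> ring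

/-- The `k`-th Fourier-harmonic block (`k ≥ 2`) of the frozen-time
linearized fast dynamics acting on the fluctuating velocity harmonics,
`L(V⁺, V⁻) = (β·(V⁺×b) − kβ·V⁻, β·(V⁻×b) + kβ·V⁺)`, is a linear bijection with the
explicit inverse stated. -/
theorem velocity_harmonic_block_bijective
    (b : E3) (hb : ‖b‖ = 1) (β : ℝ) (hβ : 0 < β) (k : ℕ) (hk : 2 ≤ k)
    (L : E3 × E3 → E3 × E3)
    (hL : ∀ Vp Vm : E3, L (Vp, Vm)
      = (β • cross Vp b - ((k : ℝ) * β) • Vm, β • cross Vm b + ((k : ℝ) * β) • Vp)) :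
    IsLinearMap ℝ L ∧ Function.Bijective L ∧
      ∀ sp sm : E3,
        L ((((k : ℝ) * β)⁻¹) •
              (dot b sm • b + (((k : ℝ) ^ 2) / ((k : ℝ) ^ 2 - 1)) • cross (cross b sm) b
                + ((k : ℝ) / ((k : ℝ) ^ 2 - 1)) • cross sp b),
           -((((k : ℝ) * β)⁻¹) •
              (dot b sp • b + (((k : ℝ) ^ 2) / ((k : ℝ) ^ 2 - 1)) • cross (cross b sp) b
                - ((k : ℝ) / ((k : ℝ) ^ 2 - 1)) • cross sm b)))
          = (sp, sm) := by
  have hbb : dot b b = 1 := by rw [dot_self_eq_norm_sq, hb, one_pow]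
  have hlin : IsLinearMap ℝ L := by
    constructor
    · rintro ⟨x, y⟩ ⟨z, w⟩
      simp only [Prod.mk_add_mk, hL, cross_add_left, Prod.mk.injEq]
      constructor <;> module
    · rintro c ⟨x, y⟩
      simp only [Prod.smul_mk, hL, cross_smul_left, Prod.mk.injEq]
      constructor <;> module
  have hk2 : (2 : ℝ) ≤ k := by exact_mod_cast hk
  have hk0 : (k : ℝ) ≠ 0 := by positivity
  have hk1 : (k : ℝ) ^ 2 - 1 ≠ 0 := by nlinarith
  have hβ0 : β ≠ 0 := hβ.ne'
  have hinv : ∀ sp sm : E3,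
        L ((((k : ℝ) * β)⁻¹) •
              (dot b sm • b + (((k : ℝ) ^ 2) / ((k : ℝ) ^ 2 - 1)) • cross (cross b sm) b
                + ((k : ℝ) / ((k : ℝ) ^ 2 - 1)) • cross sp b),
           -((((k : ℝ) * β)⁻¹) •
              (dot b sp • b + (((k : ℝ) ^ 2) / ((k : ℝ) ^ 2 - 1)) • cross (cross b sp) b
                - ((k : ℝ) / ((k : ℝ) ^ 2 - 1)) • cross sm b)))
          = (sp, sm) := by
    intro sp sm
    simp only [hL, cross_cross_left_right, hbb, ← neg_one_smul ℝ (_ : E3), sub_eq_add_neg,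
      cross_add_left, cross_smul_left, cross_self_eq_zero, cross_cross_right_right,
      Prod.mk.injEq]
    rw [sub_eq_add_neg] at hk1
    constructor <;> ext i <;>
      simp only [PiLp.add_apply, PiLp.smul_apply, PiLp.zero_apply, smul_eq_mul] <;>
      field_simp <;> ring
  refine ⟨hlin, ?_, hinv⟩
  have hsurj : Function.Surjective L := fun ⟨sp, sm⟩ => ⟨_, hinv sp sm⟩
  exact ⟨(LinearMap.injective_iff_surjective (f := hlin.mk' L)).2 hsurj, hsurj⟩

end
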